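/- arXiv:math/0209199 — 4 statements merged into one kernel-verified Lean document; each statement's English description precedes it below -/
import Mathlib

section
/- Let $S$ be a Noetherian commutative ring and let $I$ be an ideal generated by $k$ elements. Then every minimal prime over $I$ has height at most $k$; in particular $\operatorname{height}(I) \leq k$ (Krull's Height Theorem). -/
/-- Krull's Height Theorem: if `I` is an ideal of a Noetherian commutative ring
generated by `k` elements, then every minimal prime over `I` has height at most `k`;
in particular the height of `I` (the least height of a prime containing `I`) is
at most `k`. -/
theorem stmt_7 (S : Type*) [CommRing S] [IsNoetherianRing S]
    (s : Finset S) (k : ℕ) (hcard : s.card = k)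
    (I : Ideal S) (hI : I = Ideal.span (s : Set S)) :
    (∀ P ∈ I.minimalPrimes, ∀ hP : P.IsPrime,
        Order.height (⟨P, hP⟩ : PrimeSpectrum S) ≤ k) ∧
    (I ≠ ⊤ →
      sInf {h : ℕ∞ | ∃ P : PrimeSpectrum S, I ≤ P.asIdeal ∧ h = Order.height P} ≤ k) := by
  subst hI
  have key : ∀ P ∈ (Ideal.span (s : Set S)).minimalPrimes, ∀ hP : P.IsPrime,
      Order.height (⟨P, hP⟩ : PrimeSpectrum S) ≤ k := by
    intro P hPm hP
    have h := Ideal.height_le_card_of_mem_minimalPrimes_span_finset hPm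
    rw [hcard] at h
    exact (PrimeSpectrum.height_eq_orderHeight (⟨P, hP⟩ : PrimeSpectrum S)).symm.trans_le h
  refine ⟨key, fun hne => ?_⟩
  obtain ⟨P, hPm⟩ := Ideal.nonempty_minimalPrimes hne
  refine le_trans (sInf_le ?_) (key P hPm hPm.1.1)
  exact ⟨⟨P, hPm.1.1⟩, hPm.1.2, rfl⟩
end

section
/- Let $S$ be a regular local ring and $I$ a height-two ideal such that $R = S/I$ is Gorenstein. Then $I$ is generated by two elements, i.e., $R$ is a complete intersection. -/
set_option synthInstance.maxHeartbeats 800000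

/-- A Noetherian local ring is regular if its maximal ideal is generated by
`dim R` elements. -/
def IsRegularLocal (S : Type) [CommRing S] [IsLocalRing S] : Prop :=
  ∃ s : Finset S, Ideal.span (s : Set S) = IsLocalRing.maximalIdeal S ∧
    (s.card : WithBot (WithTop ℕ)) = ringKrullDim S

/-- A local ring is Cohen–Macaulay if some system of parameters is a regular
sequence. -/
def IsCohenMacaulayLocal (R : Type) [CommRing R] [IsLocalRing R] : Prop :=
  ∃ rs : List R, (rs.length : WithBot (WithTop ℕ)) = ringKrullDim R ∧
    (Ideal.span {x | x ∈ rs}).radical = IsLocalRing.maximalIdeal R ∧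
    RingTheory.Sequence.IsRegular R rs

/-- The height of an ideal: the least height of a prime containing it. -/
noncomputable def idealHeight {S : Type} [CommRing S] (I : Ideal S) : ℕ∞ :=
  sInf {h : ℕ∞ | ∃ P : PrimeSpectrum S, I ≤ P.asIdeal ∧ h = Order.height P}

/-- `Ext^i_S(M, S)` as an `S`-module. -/
noncomputable def ExtSMod (S : Type) [CommRing S] (M : Type) [AddCommGroup M]
    [Module S M] (i : ℕ) : ModuleCat S :=
  ((Ext S (ModuleCat S) i).obj (Opposite.op (ModuleCat.of S M))).obj (ModuleCat.of S S)


open CategoryTheory in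
theorem extMk_smul' (S : Type) [CommRing S] (X Y : ModuleCat.{0} S) (P : ProjectiveResolution X)
    (r : S) (f : P.complex.X 2 ⟶ Y) (hf : P.complex.d 3 2 ≫ f = 0)
    (hf' : P.complex.d 3 2 ≫ (r • f) = 0) :
    P.extMk (r • f) 3 rfl hf' = r • P.extMk f 3 rfl hf := by
  rw [Abelian.Ext.smul_eq_comp_mk₀, P.extMk_comp_mk₀]
  congr 1

open CategoryTheory in
theorem bridge (S : Type) [CommRing S] (X Y : ModuleCat.{0} S) :
    Nonempty (((Ext S (ModuleCat S) 2).obj (Opposite.op X)).obj Y ≃ₗ[S] Abelian.Ext X Y 2) := by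
  obtain ⟨⟨P⟩⟩ := (inferInstance : HasProjectiveResolution X)
  let C := P.complex.linearYonedaObj S Y
  let T : ShortComplex (ModuleCat S) := C.sc' 1 2 3
  let e : C.homology 2 ≅ T.homology :=
    ShortComplex.homologyMapIso (C.isoSc' 1 2 3 (by simp) (by simp))
  have hg : ∀ f : (P.complex.X 2 ⟶ Y), (T.g.hom f : P.complex.X 3 ⟶ Y) = P.complex.d 3 2 ≫ f :=
    fun f => rfl
  have hf : ∀ f : (P.complex.X 1 ⟶ Y), (T.f.hom f : P.complex.X 2 ⟶ Y) = P.complex.d 2 1 ≫ f :=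
    fun f => rfl
  let L : LinearMap.ker T.g.hom →ₗ[S] Abelian.Ext X Y 2 :=
    { toFun := fun f => P.extMk (n := 2) (f.1 : P.complex.X 2 ⟶ Y) 3 rfl f.2
      map_add' := fun f g => (P.add_extMk (n := 2) _ _ 3 rfl f.2 g.2).symm
      map_smul' := fun r f => (extMk_smul' S X Y P r (f.1 : P.complex.X 2 ⟶ Y) f.2
        (r • f).2) }
  have hLs : Function.Surjective L := by
    intro a
    obtain ⟨f, hf, h⟩ := P.extMk_surjective a 3 rfl
    exact ⟨⟨f, hf⟩, h⟩
  have hLk : LinearMap.ker L = LinearMap.range T.moduleCatToCycles := by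
    ext f
    refine (P.extMk_eq_zero_iff (n := 2) f.1 3 rfl f.2 1 rfl).trans ?_
    constructor
    · rintro ⟨g, h⟩
      exact ⟨g, Subtype.ext h⟩
    · rintro ⟨g, h⟩
      exact ⟨g, congrArg Subtype.val h⟩
  have e3 : (LinearMap.ker T.g.hom ⧸ LinearMap.range T.moduleCatToCycles) ≃ₗ[S] Abelian.Ext X Y 2 :=
    (Submodule.quotEquivOfEq _ _ hLk.symm).trans (L.quotKerEquivOfSurjective hLs)
  exact ⟨((P.isoExt 2 Y ≪≫ e ≪≫ T.moduleCatHomologyIso).toLinearEquiv).trans e3⟩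


open IsLocalRing in
theorem exists_good_elt (S : Type) [CommRing S] [IsLocalRing S] [IsNoetherianRing S]
    (n : ℕ) (hd : ringKrullDim S = ((n + 1 : ℕ) : WithBot ℕ∞)) :
    ∃ y ∈ maximalIdeal S, y ∉ (maximalIdeal S) ^ 2 ∧ ∀ p ∈ (⊥ : Ideal S).minimalPrimes, y ∉ p := by
  classical
  by_contra hcon
  push Not at hcon
  have hfin := Ideal.finite_minimalPrimes_of_isNoetherianRing S ⊥
  have h := (Ideal.subset_union_prime (s := insert ((maximalIdeal S) ^ 2) hfin.toFinset)
    (f := fun i : Ideal S => i) ((maximalIdeal S) ^ 2) ((maximalIdeal S) ^ 2) (by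
      intro i hi h1 _
      simp only [Finset.mem_insert, Set.Finite.mem_toFinset] at hi
      rcases hi with hi | hi
      · exact absurd hi h1
      · exact hi.1.1) (I := maximalIdeal S)).1 (by
      intro y hy
      by_cases h2 : y ∈ (maximalIdeal S) ^ 2
      · simp only [Set.mem_iUnion]
        exact ⟨_, by simp, h2⟩
      · obtain ⟨p, hp, hyp⟩ := hcon y hy h2
        simp only [Set.mem_iUnion]
        exact ⟨p, by simp [hp], hyp⟩)
  have hne : ringKrullDim S ≠ 0 := by
    rw [hd]
    norm_cast
  obtain ⟨i, hi, hle⟩ := h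
  simp only [Finset.mem_insert, Set.Finite.mem_toFinset] at hi
  apply hne
  rw [← maximalIdeal_height_eq_ringKrullDim]
  suffices (maximalIdeal S) ∈ minimalPrimes S by
    have := Ideal.height_eq_zero_iff.2 this
    simp [this]
  rcases hi with rfl | hi
  · have : maximalIdeal S = ⊥ := by
      refine Submodule.eq_bot_of_le_smul_of_le_jacobson_bot (maximalIdeal S) (maximalIdeal S)
        (IsNoetherian.noetherian _) ?_ (maximalIdeal_le_jacobson _)
      rwa [smul_eq_mul, ← pow_two]
    have hb : (⊥ : Ideal S).IsPrime := this ▸ inferInstance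
    rw [this]
    refine ⟨⟨hb, bot_le⟩, fun _ _ _ => bot_le⟩
  · have hp : i.IsPrime := hi.1.1
    have : i = maximalIdeal S := le_antisymm (le_maximalIdeal hp.ne_top) hle
    rwa [← this]

open IsLocalRing RingTheory.Sequence Pointwise in
theorem regular_seq (n : ℕ) : ∀ (S : Type) [CommRing S] [IsLocalRing S] [IsNoetherianRing S]
    (x : Fin n → S) (_ : Ideal.span (Set.range x) = maximalIdeal S)
    (_ : ringKrullDim S = (n : WithBot ℕ∞)),
    IsDomain S ∧ ∃ rs : List S, rs.length = n ∧ Ideal.ofList rs = maximalIdeal S ∧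
      IsWeaklyRegular S rs := by
  induction n with
  | zero =>
    intro S _ _ _ x hx hd
    have hx : (⊥ : Ideal S) = maximalIdeal S := by
      rw [← hx]; simp
    have : (⊥ : Ideal S).IsPrime := hx ▸ inferInstance
    exact ⟨IsDomain.of_bot_isPrime S, [], rfl, by simpa using hx, by simp⟩
  | succ n ih =>
    intro S _ _ _ x hx hd
    obtain ⟨y, hym, hy2, hyp⟩ := exists_good_elt S n hd
    have hy' := hym
    rw [← hx, Ideal.mem_span_range_iff_exists_fun] at hy'
    obtain ⟨c, hc⟩ := hy'
    have hxm : ∀ i, x i ∈ maximalIdeal S := fun i => by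
      rw [← hx]; exact Ideal.subset_span ⟨i, rfl⟩
    obtain ⟨i, hi⟩ : ∃ i, IsUnit (c i) := by
      by_contra hcon
      push Not at hcon
      apply hy2
      rw [← hc, pow_two]
      exact Ideal.sum_mem _ fun i _ => Ideal.mul_mem_mul ((mem_maximalIdeal _).2 (hcon i)) (hxm i)
    let z : Fin n → S := fun j => x (i.succAbove j)
    have hspan : maximalIdeal S = Ideal.span {y} ⊔ Ideal.span (Set.range z) := by
      apply le_antisymm
      · rw [← hx, Ideal.span_le]
        have hz : ∀ j, x (i.succAbove j) ∈ Ideal.span {y} ⊔ Ideal.span (Set.range z) := fun j =>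
          Ideal.mem_sup_right (Ideal.subset_span ⟨j, rfl⟩)
        rintro _ ⟨k, rfl⟩
        rcases Fin.eq_self_or_eq_succAbove i k with rfl | ⟨j, rfl⟩
        · rw [Fin.sum_univ_succAbove _ k] at hc
          have h1 : c k * x k ∈ Ideal.span {y} ⊔ Ideal.span (Set.range z) := by
            rw [← eq_sub_iff_add_eq] at hc
            rw [hc]
            refine Ideal.sub_mem _ (Ideal.mem_sup_left (Ideal.mem_span_singleton_self y)) ?_
            exact Ideal.sum_mem _ fun j _ => Ideal.mul_mem_left _ _ (hz j)
          exact (Ideal.unit_mul_mem_iff_mem _ hi).1 h1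
        · exact hz j
      · rw [sup_le_iff, Ideal.span_le, Ideal.span_le]
        refine ⟨by simpa using hym, ?_⟩
        rintro _ ⟨j, rfl⟩
        exact hxm _
    have hne : Ideal.span {y} ≠ ⊤ := fun h => by
      have : Ideal.span {y} ≤ maximalIdeal S := by simpa [Ideal.span_le] using hym
      rw [h, top_le_iff] at this
      exact (Ideal.IsPrime.ne_top' : maximalIdeal S ≠ ⊤) this
    have : Nontrivial (S ⧸ Ideal.span {y}) := Ideal.Quotient.nontrivial_iff.2 hne
    have : IsLocalRing (S ⧸ Ideal.span {y}) :=
      IsLocalRing.of_surjective' (Ideal.Quotient.mk _) Ideal.Quotient.mk_surjective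
    have hsp : y • (⊤ : Ideal S) = Ideal.span {y} := by
      exact (Submodule.ideal_span_singleton_smul y ⊤).symm.trans (by simp)
    have hmap := IsLocalRing.map_maximalIdeal_of_surjective (Ideal.Quotient.mk (Ideal.span {y}))
      Ideal.Quotient.mk_surjective
    obtain ⟨hdom, rs, hlen, hrs, hreg⟩ := ih (S ⧸ Ideal.span {y})
      (fun j => Ideal.Quotient.mk _ (z j)) (by
        rw [← hmap, hspan, Ideal.map_sup, Ideal.map_quotient_self, bot_sup_eq, Ideal.map_span,
          ← Set.range_comp]
        rfl) (by
        have h := Module.supportDim_quotSMulTop_succ_eq_of_notMem_minimalPrimes_of_mem_maximalIdeal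
          (R := S) (M := S) (x := y) (by
            rwa [Module.annihilator_eq_bot.2 inferInstance]) hym
        rw [Module.supportDim_self_eq_ringKrullDim, hd,
          Module.supportDim_eq_of_equiv (Submodule.quotEquivOfEq _ _ hsp),
          Module.supportDim_quotient_eq_ringKrullDim] at h
        push_cast at h
        exact ENat.WithBot.add_one_cancel.1 h)
    have hprime : (Ideal.span {y}).IsPrime := (Ideal.Quotient.isDomain_iff_prime _).1 hdom
    obtain ⟨q, hq, hqle⟩ := Ideal.exists_minimalPrimes_le (bot_le : ⊥ ≤ Ideal.span {y})
    have hqp : q.IsPrime := hq.1.1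
    have hyq := hyp q hq
    have hqb : q = ⊥ := by
      refine Submodule.eq_bot_of_le_smul_of_le_jacobson_bot (maximalIdeal S) q
        (IsNoetherian.noetherian _) ?_ (maximalIdeal_le_jacobson _)
      intro a ha
      obtain ⟨b, rfl⟩ := Ideal.mem_span_singleton'.1 (hqle ha)
      have hb := (hqp.mem_or_mem ha).resolve_right hyq
      rw [mul_comm]
      exact Ideal.mul_mem_mul hym hb
    subst hqb
    have hD : IsDomain S := IsDomain.of_bot_isPrime S
    refine ⟨hD, y :: rs.map (Function.surjInv Ideal.Quotient.mk_surjective), by simp [hlen], ?_, ?_⟩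
    · have hrr : (rs.map (Function.surjInv (Ideal.Quotient.mk_surjective (I := Ideal.span {y})))).map
          (Ideal.Quotient.mk (Ideal.span {y})) = rs := by
        simp [Function.comp_def, Function.surjInv_eq]
      set rs' := rs.map (Function.surjInv (Ideal.Quotient.mk_surjective (I := Ideal.span {y})))
      rw [Ideal.ofList_cons]
      have h1 : (Ideal.ofList rs').map (Ideal.Quotient.mk (Ideal.span {y})) =
          (maximalIdeal S).map (Ideal.Quotient.mk (Ideal.span {y})) := by
        rw [Ideal.map_ofList, hrr, hrs, hmap]
      have h2 := congrArg (Ideal.comap (Ideal.Quotient.mk (Ideal.span {y}))) h1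
      rw [Ideal.comap_map_of_surjective _ Ideal.Quotient.mk_surjective,
        Ideal.comap_map_of_surjective _ Ideal.Quotient.mk_surjective] at h2
      rw [← RingHom.ker_eq_comap_bot, Ideal.mk_ker] at h2
      rw [sup_comm, h2, sup_eq_left]
      simpa [Ideal.span_le] using hym
    · have hrr : (rs.map (Function.surjInv (Ideal.Quotient.mk_surjective (I := Ideal.span {y})))).map
          (algebraMap S (S ⧸ Ideal.span {y})) = rs := by
        simp [Function.comp_def, Function.surjInv_eq]
      rw [isWeaklyRegular_cons_iff]
      refine ⟨?_, ?_⟩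
      · have hy0 : y ≠ 0 := fun h => hyq (by simp [h])
        exact fun a b h => mul_left_cancel₀ hy0 h
      · rw [LinearEquiv.isWeaklyRegular_congr (Submodule.quotEquivOfEq _ _ hsp),
          ← isWeaklyRegular_map_algebraMap_iff (S ⧸ Ideal.span {y}), hrr]
        exact hreg


open IsLocalRing CategoryTheory in
theorem pd_finite_length (S : Type) [CommRing S] [IsLocalRing S] [IsNoetherianRing S] (n : ℕ)
    (hk : HasProjectiveDimensionLT (ModuleCat.of S (S ⧸ maximalIdeal S)) n)
    (M : Type) [AddCommGroup M] [Module S M] (hM : Module.Finite S M) :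
    Module.support S M ⊆ PrimeSpectrum.zeroLocus (maximalIdeal S) →
      HasProjectiveDimensionLT (ModuleCat.of S M) n := by
  induction hM using IsNoetherianRing.induction_on_isQuotientEquivQuotientPrime S with
  | subsingleton N =>
    intro _
    have := (ModuleCat.isZero_of_subsingleton (ModuleCat.of S N)).hasProjectiveDimensionLT_zero
    exact hasProjectiveDimensionLT_of_ge _ 0 n (Nat.zero_le _)
  | quotient N p f =>
    intro h
    rw [f.support_eq, Module.support_eq_zeroLocus, Ideal.annihilator_quotient] at h
    have h1 : maximalIdeal S ≤ p.1 := by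
      have := h (show p ∈ _ from le_refl (p.1 : Set S))
      exact this
    have h2 : maximalIdeal S = p.1 := le_antisymm h1 (le_maximalIdeal p.2.ne_top)
    have e : (S ⧸ maximalIdeal S) ≃ₗ[S] N := (Submodule.quotEquivOfEq _ _ h2).trans f.symm
    exact hasProjectiveDimensionLT_of_iso e.toModuleIso n
  | exact N₁ N₂ N₃ f g hf hg hfg h₁ h₃ =>
    intro h
    have hse : (ModuleCat.shortComplexOfCompEqZero f g hfg.linearMap_comp_eq_zero).ShortExact :=
      ModuleCat.shortComplex_shortExact _ hfg hf hg
    exact hse.hasProjectiveDimensionLT_X₂ n (h₁ ((Module.support_subset_of_injective f hf).trans h))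
      (h₃ ((Module.support_subset_of_surjective g hg).trans h))

open IsLocalRing CategoryTheory Pointwise in
theorem ext_descend (S : Type) [CommRing S] [IsLocalRing S] [IsNoetherianRing S]
    (M L : ModuleCat.{0} S) [Module.Finite S M] [Module.Finite S L] (x : S)
    (reg : IsSMulRegular M x) (mem : x ∈ maximalIdeal S) (n : ℕ)
    (zero : Subsingleton (Abelian.Ext (ModuleCat.of S (QuotSMulTop x M)) L (n + 1))) :
    Subsingleton (Abelian.Ext M L n) := by
  let T := M.smulShortComplex x
  have hS : T.ShortExact := reg.smulShortComplex_shortExact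
  have epi : ∀ y : Abelian.Ext M L n, ∃ z : Abelian.Ext M L n, x • z = y := by
    intro y
    obtain ⟨z, hz⟩ := Abelian.Ext.contravariant_sequence_exact₁ hS L (n₁ := n + 1)
      (show Abelian.Ext T.X₁ L n from y) (add_comm 1 n) (@Subsingleton.elim _ zero _ _)
    have hz2 : ∀ z' : Abelian.Ext M L n, (Abelian.Ext.mk₀ (x • 𝟙 M)).comp z' (zero_add n) =
        x • z' := by
      intro z'
      rw [Abelian.Ext.mk₀_smul, Abelian.Ext.smul_comp, Abelian.Ext.mk₀_id_comp]
    exact ⟨z, (hz2 z).symm.trans hz⟩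
  by_contra! ntr
  have : x ∈ (Module.annihilator S (Abelian.Ext M L n)).jacobson :=
    (IsLocalRing.maximalIdeal_le_jacobson _) mem
  absurd Submodule.top_ne_pointwise_smul_of_mem_jacobson_annihilator this
  rw [eq_comm, eq_top_iff]
  intro y hy
  rcases epi y with ⟨z, hz⟩
  rw [← hz]
  exact Submodule.smul_mem_pointwise_smul _ _ ⊤ trivial

open IsLocalRing CategoryTheory RingTheory.Sequence in
theorem ext_descend_list (S : Type) [CommRing S] [IsLocalRing S] [IsNoetherianRing S]
    (L : ModuleCat.{0} S) [Module.Finite S L] (rs : List S) (mem : ∀ r ∈ rs, r ∈ maximalIdeal S) :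
    ∀ (M : ModuleCat.{0} S) [Module.Finite S M]
    (_ : IsWeaklyRegular M rs) (n : ℕ)
    (_ : Subsingleton (Abelian.Ext (ModuleCat.of S (M ⧸ Ideal.ofList rs • (⊤ : Submodule S M))) L
      (n + rs.length))),
    Subsingleton (Abelian.Ext M L n) := by
  have key : ∀ (A B : ModuleCat.{0} S) (e : A ≅ B) (m : ℕ), Subsingleton (Abelian.Ext A L m) →
      Subsingleton (Abelian.Ext B L m) := by
    intro A B e m h
    refine ⟨fun a b => ?_⟩
    have h1 : ∀ c : Abelian.Ext B L m, c = (Abelian.Ext.mk₀ e.inv).comp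
        ((Abelian.Ext.mk₀ e.hom).comp c (zero_add m)) (zero_add m) := by
      intro c
      simp
    rw [h1 a, h1 b, Subsingleton.elim ((Abelian.Ext.mk₀ e.hom).comp a (zero_add m))
      ((Abelian.Ext.mk₀ e.hom).comp b (zero_add m))]
  induction rs with
  | nil =>
    intro M _ _ n h
    refine key _ M ?_ _ h
    exact (Submodule.quotEquivOfEqBot _ (by simp)).toModuleIso
  | cons x rs ih =>
    intro M _ reg n h
    simp only [List.mem_cons, forall_eq_or_imp] at mem
    simp only [isWeaklyRegular_cons_iff] at reg
    refine ext_descend S M L x reg.1 mem.1 n ?_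
    refine ih mem.2 (ModuleCat.of S (QuotSMulTop x M)) reg.2 (n + 1) ?_
    have h2 := key _ _ (Submodule.quotOfListConsSMulTopEquivQuotSMulTopInner M x rs).toModuleIso _ h
    have : n + (x :: rs).length = n + 1 + rs.length := by simp; omega
    rwa [this] at h2

open IsLocalRing CategoryTheory RingTheory.Sequence in
theorem pd_two (S : Type) [CommRing S] [IsLocalRing S] [IsNoetherianRing S]
    (ys : List S) (hys : Ideal.ofList ys = maximalIdeal S) (hyreg : IsWeaklyRegular S ys)
    (I : Ideal S) [IsLocalRing (S ⧸ I)] (hCM : IsCohenMacaulayLocal (S ⧸ I))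
    (hExt : Nontrivial (Abelian.Ext (ModuleCat.of S (S ⧸ I)) (ModuleCat.of S S) 2)) :
    HasProjectiveDimensionLT (ModuleCat.of S (S ⧸ I)) 3 := by
  have hymem : ∀ y ∈ ys, y ∈ maximalIdeal S := fun y hy => by
    rw [← hys]; exact Ideal.subset_span hy
  have hyreg' : IsRegular S ys :=
    (IsLocalRing.isRegular_iff_isWeaklyRegular_of_subset_maximalIdeal hymem).2 hyreg
  have hk : projectiveDimension (ModuleCat.of S (S ⧸ maximalIdeal S)) = ys.length := by
    rw [← ModuleCat.projectiveDimension_quotient_eq_length ys hyreg']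
    refine projectiveDimension_eq_of_iso (LinearEquiv.toModuleIso ?_)
    exact (Submodule.quotEquivOfEq _ _ hys.symm).trans (Shrink.linearEquiv S _).symm
  have hk' : HasProjectiveDimensionLT (ModuleCat.of S (S ⧸ maximalIdeal S)) (ys.length + 1) :=
    (projectiveDimension_le_iff _ _).1 hk.le
  obtain ⟨rs, -, hrad, hreg⟩ := hCM
  let xs := rs.map (Function.surjInv (Ideal.Quotient.mk_surjective (I := I)))
  have hxs : xs.map (algebraMap S (S ⧸ I)) = rs := by
    simp [xs, Function.comp_def, Function.surjInv_eq]
  have hxs' : xs.map (Ideal.Quotient.mk I) = rs := hxs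
  have hmx : ∀ x ∈ xs, x ∈ maximalIdeal S := by
    intro x hx
    have h1 : Ideal.Quotient.mk I x ∈ rs := by
      rw [← hxs']; exact List.mem_map_of_mem hx
    have h2 : Ideal.Quotient.mk I x ∈ maximalIdeal (S ⧸ I) := by
      rw [← hrad]; exact Ideal.le_radical (Ideal.subset_span h1)
    rw [mem_maximalIdeal, mem_nonunits_iff] at h2 ⊢
    exact fun h => h2 (h.map _)
  have hxreg : IsWeaklyRegular (S ⧸ I) xs := by
    rw [← isWeaklyRegular_map_algebraMap_iff (S ⧸ I), hxs]
    exact hreg.1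
  let N := (S ⧸ I) ⧸ Ideal.ofList xs • (⊤ : Submodule S (S ⧸ I))
  have hsupp : Module.support S N ⊆ PrimeSpectrum.zeroLocus (maximalIdeal S) := by
    rw [Module.support_eq_zeroLocus, PrimeSpectrum.zeroLocus_subset_zeroLocus_iff]
    intro a ha
    have h1 : Ideal.Quotient.mk I a ∈ maximalIdeal (S ⧸ I) := by
      rw [mem_maximalIdeal, mem_nonunits_iff] at ha ⊢
      intro h
      have hloc : IsLocalHom (Ideal.Quotient.mk I) :=
        IsLocalHom.of_surjective _ Ideal.Quotient.mk_surjective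
      exact ha (hloc.map_nonunit _ h)
    rw [← hrad] at h1
    obtain ⟨k, hk⟩ := h1
    refine ⟨k, ?_⟩
    rw [Module.mem_annihilator]
    intro b
    obtain ⟨b, rfl⟩ := Submodule.Quotient.mk_surjective _ b
    rw [← Submodule.Quotient.mk_smul, Submodule.Quotient.mk_eq_zero, Ideal.smul_top_eq_map,
      Ideal.map_ofList, hxs]
    rw [← map_pow] at hk
    rw [Algebra.smul_def]
    exact Ideal.mul_mem_right _ _ hk
  have hpdN : HasProjectiveDimensionLT (ModuleCat.of S N) (ys.length + 1) :=
    pd_finite_length S _ hk' N inferInstance hsupp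
  have hle : ys.length ≤ xs.length + 2 := by
    by_contra hcon
    push Not at hcon
    refine not_subsingleton _ (ext_descend_list S (ModuleCat.of S S) xs hmx
      (ModuleCat.of S (S ⧸ I)) hxreg 2 ?_)
    refine ModuleCat.subsingleton_ext_of_exists_isRegular (maximalIdeal S) (ModuleCat.of S N)
      hsupp (ModuleCat.of S S) ?_ ys hymem hyreg' _ (by omega)
    rw [lt_top_iff_ne_top]
    change maximalIdeal S • (⊤ : Submodule S S) ≠ ⊤
    simpa using (Ideal.IsPrime.ne_top' : maximalIdeal S ≠ ⊤)
  have hpd := ModuleCat.projectiveDimension_quotient_eq_add_length_of_isWeaklyRegular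
    (ModuleCat.of S (S ⧸ I)) xs hxreg hmx
  have h3 : projectiveDimension (ModuleCat.of S N) ≤ (ys.length : ℕ) :=
    (projectiveDimension_le_iff _ _).2 hpdN
  have h4 : projectiveDimension (ModuleCat.of S (S ⧸ I)) + (xs.length : ℕ) ≤ ((2 : ℕ) : WithBot ℕ∞) + (xs.length : ℕ) := by
    refine hpd.symm.le.trans (h3.trans ?_)
    have : ys.length ≤ 2 + xs.length := by omega
    exact_mod_cast this
  refine (projectiveDimension_le_iff _ 2).1 ?_
  rwa [ENat.WithBot.add_le_add_natCast_right_iff] at h4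

open CategoryTheory in
theorem hom_cyclic (S : Type) [CommRing S] (I : Ideal S)
    (F : Type) [AddCommGroup F] [Module S F] [Module.Projective S F]
    (f : F →ₗ[S] I) (hf : Function.Surjective f)
    (e : Abelian.Ext (ModuleCat.of S (S ⧸ I)) (ModuleCat.of S S) 2 ≃ₗ[S] (S ⧸ I)) :
    ∃ ψ₀ : LinearMap.ker f →ₗ[S] S, ∀ ψ : LinearMap.ker f →ₗ[S] S, ∃ (c : S) (φ : F →ₗ[S] S),
      ψ = c • ψ₀ + φ ∘ₗ (LinearMap.ker f).subtype := by
  let A := ModuleCat.of S S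
  let T₁ := f.shortComplexKer
  have h₁ : T₁.ShortExact := LinearMap.shortExact_shortComplexKer hf
  let T₂ := ModuleCat.shortComplexOfCompEqZero I.subtype I.mkQ (LinearMap.exact_subtype_mkQ I).linearMap_comp_eq_zero
  have h₂ : T₂.ShortExact := by
    refine ModuleCat.shortComplex_shortExact _ ?_ ?_ ?_
    · exact LinearMap.exact_subtype_mkQ I
    · exact Subtype.val_injective
    · exact Submodule.mkQ_surjective I
  have p₁ : Projective T₁.X₂ :=
    (IsProjective.iff_projective _).1 (inferInstanceAs (Module.Projective S F))
  have p₂ : Projective T₂.X₂ :=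
    (IsProjective.iff_projective _).1 (inferInstanceAs (Module.Projective S S))
  let δ₁ : Abelian.Ext T₁.X₁ A 0 →ₗ[S] Abelian.Ext T₁.X₃ A 1 :=
    h₁.extClass.precompOfLinear S A (add_comm 1 0)
  let δ₂ : Abelian.Ext T₂.X₁ A 1 →ₗ[S] Abelian.Ext T₂.X₃ A 2 :=
    h₂.extClass.precompOfLinear S A (add_comm 1 1)
  have s₁ : Function.Surjective δ₁ := precomp_extClass_surjective_of_projective_X₂ A h₁ 0
  have s₂ : Function.Surjective δ₂ := precomp_extClass_surjective_of_projective_X₂ A h₂ 1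
  have i₂ : ∀ x, δ₂ x = 0 → x = 0 := by
    intro x hx
    obtain ⟨z, hz⟩ := Abelian.Ext.contravariant_sequence_exact₁ h₂ A x (add_comm 1 1) hx
    rw [← hz, Abelian.Ext.eq_zero_of_projective z, Abelian.Ext.comp_zero]
  have i₁ : ∀ x, δ₁ x = 0 → ∃ φ : F →ₗ[S] S,
      x = Abelian.Ext.mk₀ (ModuleCat.ofHom (φ ∘ₗ (LinearMap.ker f).subtype)) := by
    intro x hx
    obtain ⟨z, hz⟩ := Abelian.Ext.contravariant_sequence_exact₁ h₁ A x (add_comm 1 0) hx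
    obtain ⟨φ, rfl⟩ := (Abelian.Ext.mk₀_bijective _ _).2 z
    refine ⟨φ.hom, ?_⟩
    rw [← hz, Abelian.Ext.mk₀_comp_mk₀]
    rfl
  let Φ : Abelian.Ext T₁.X₁ A 0 →ₗ[S] (S ⧸ I) := e.toLinearMap ∘ₗ δ₂ ∘ₗ δ₁
  have sΦ : Function.Surjective Φ := e.surjective.comp (s₂.comp s₁)
  obtain ⟨x₀, hx₀⟩ := sΦ 1
  obtain ⟨ψ₀, rfl⟩ := (Abelian.Ext.mk₀_bijective _ _).2 x₀
  refine ⟨ψ₀.hom, fun ψ => ?_⟩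
  obtain ⟨c, hc⟩ := Ideal.Quotient.mk_surjective (Φ (Abelian.Ext.mk₀ (ModuleCat.ofHom ψ)))
  have h0 : Φ (Abelian.Ext.mk₀ (ModuleCat.ofHom ψ) - c • Abelian.Ext.mk₀ ψ₀) = 0 := by
    rw [map_sub, map_smul, hx₀, ← hc, Algebra.smul_def, mul_one]
    exact sub_self _
  have h1 := i₁ _ (i₂ _ (e.map_eq_zero_iff.1 h0))
  obtain ⟨φ, hφ⟩ := h1
  refine ⟨c, φ, ?_⟩
  rw [sub_eq_iff_eq_add, ← Abelian.Ext.mk₀_smul, ← Abelian.Ext.mk₀_add] at hφ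
  have h2 := (Abelian.Ext.mk₀_bijective _ _).1 hφ
  have h3 := congrArg ModuleCat.Hom.hom h2
  rw [add_comm]
  exact h3

open IsLocalRing in
theorem ker_finrank_le_one (S : Type) [CommRing S] [IsLocalRing S] [IsDomain S]
    (F : Type) [AddCommGroup F] [Module S F]
    (K : Submodule S F) [Module.Free S K] [Module.Finite S K]
    (hK : K ≤ maximalIdeal S • (⊤ : Submodule S F))
    (ψ₀ : K →ₗ[S] S)
    (h : ∀ ψ : K →ₗ[S] S, ∃ (c : S) (φ : F →ₗ[S] S), ψ = c • ψ₀ + φ ∘ₗ K.subtype) :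
    Module.finrank S K ≤ 1 := by
  classical
  let b := Module.Free.chooseBasis S K
  have htop : (⊤ : Submodule S (Module.Dual S K)) ≤ Submodule.span S {ψ₀} := by
    refine Submodule.le_of_le_smul_of_le_jacobson_bot (I := maximalIdeal S) Module.Finite.fg_top
      (maximalIdeal_le_jacobson _) ?_
    intro ψ _
    obtain ⟨c, φ, rfl⟩ := h ψ
    refine Submodule.add_mem_sup (Submodule.smul_mem _ _ (Submodule.mem_span_singleton_self _)) ?_
    have h1 : φ ∘ₗ K.subtype = ∑ i, φ (b i) • b.coord i :=
      (b.sum_dual_apply_smul_coord (φ ∘ₗ K.subtype)).symm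
    rw [h1]
    refine Submodule.sum_mem _ fun i _ => Submodule.smul_mem_smul ?_ trivial
    have h2 : φ (b i) ∈ (maximalIdeal S • (⊤ : Submodule S F)).map φ :=
      Submodule.mem_map_of_mem (hK (b i).2)
    rw [Submodule.map_smul''] at h2
    exact (Submodule.smul_le.2 (fun r hr n _ => Ideal.mul_mem_right n _ hr) :
      maximalIdeal S • (Submodule.map φ ⊤) ≤ maximalIdeal S) h2
  rw [b.toDualEquiv.finrank_eq]
  refine finrank_le_one ψ₀ fun ψ => ?_
  exact Submodule.mem_span_singleton.1 (htop (x := ψ) trivial)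

open IsLocalRing in
theorem min_gens (S : Type) [CommRing S] [IsLocalRing S] [IsNoetherianRing S] (I : Ideal S) :
    ∃ (r : ℕ) (v : Fin r → I), Submodule.span S (Set.range v) = ⊤ ∧
      LinearMap.ker (Fintype.linearCombination S v) ≤
        maximalIdeal S • (⊤ : Submodule S (Fin r → S)) := by
  classical
  have hex : ∃ r : ℕ, ∃ v : Fin r → I, Submodule.span S (Set.range v) = ⊤ :=
    Module.Finite.exists_fin
  obtain ⟨v, hv⟩ := Nat.find_spec hex
  have hmin := fun m => Nat.find_min (m := m) hex
  generalize Nat.find hex = r at v hv hmin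
  refine ⟨r, v, hv, ?_⟩
  intro k hk
  rw [LinearMap.mem_ker, Fintype.linearCombination_apply] at hk
  have hkm : ∀ i, k i ∈ maximalIdeal S := by
    intro i
    by_contra hi
    rw [mem_maximalIdeal, mem_nonunits_iff, not_not] at hi
    cases r with
    | zero => exact i.elim0
    | succ r =>
      refine hmin r (Nat.lt_succ_self r) ⟨fun j => v (i.succAbove j), ?_⟩
      rw [eq_top_iff, ← hv, Submodule.span_le]
      set W := Submodule.span S (Set.range fun j => v (i.succAbove j)) with hW
      have hz : ∀ j, v (i.succAbove j) ∈ W := fun j => Submodule.subset_span ⟨j, rfl⟩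
      rintro _ ⟨l, rfl⟩
      rcases Fin.eq_self_or_eq_succAbove i l with rfl | ⟨j, rfl⟩
      · rw [Fin.sum_univ_succAbove _ l, add_eq_zero_iff_eq_neg] at hk
        have h1 : k l • v l ∈ W := by
          rw [hk]
          exact W.neg_mem (W.sum_mem fun j _ => W.smul_mem _ (hz j))
        exact (Submodule.smul_mem_iff_of_isUnit W hi).1 h1
      · exact hz j
  rw [pi_eq_sum_univ' k]
  exact Submodule.sum_mem _ fun i _ => Submodule.smul_mem_smul (hkm i) trivial

open IsLocalRing CategoryTheory in
theorem two_gens (S : Type) [CommRing S] [IsLocalRing S] [IsNoetherianRing S] [IsDomain S]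
    (I : Ideal S)
    (hpd : HasProjectiveDimensionLT (ModuleCat.of S (S ⧸ I)) 3)
    (e : Abelian.Ext (ModuleCat.of S (S ⧸ I)) (ModuleCat.of S S) 2 ≃ₗ[S] (S ⧸ I)) :
    ∃ f g : S, I = Ideal.span {f, g} := by
  obtain ⟨r, v, hv, hker⟩ := min_gens S I
  let f := Fintype.linearCombination S v
  have hf : Function.Surjective f := by
    rw [← LinearMap.range_eq_top, Fintype.range_linearCombination, hv]
  let T₁ := f.shortComplexKer
  have h₁ : T₁.ShortExact := LinearMap.shortExact_shortComplexKer hf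
  let T₂ := ModuleCat.shortComplexOfCompEqZero I.subtype I.mkQ (LinearMap.exact_subtype_mkQ I).linearMap_comp_eq_zero
  have h₂ : T₂.ShortExact := by
    refine ModuleCat.shortComplex_shortExact _ ?_ ?_ ?_
    · exact LinearMap.exact_subtype_mkQ I
    · exact Subtype.val_injective
    · exact Submodule.mkQ_surjective I
  have p₁ : Projective T₁.X₂ :=
    (IsProjective.iff_projective _).1 (inferInstanceAs (Module.Projective S (Fin r → S)))
  have p₂ : Projective T₂.X₂ :=
    (IsProjective.iff_projective _).1 (inferInstanceAs (Module.Projective S S))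
  have q₁ : HasProjectiveDimensionLT T₂.X₁ 2 := (h₂.hasProjectiveDimensionLT_X₃_iff 1 p₂).1 hpd
  have q₂ : HasProjectiveDimensionLT T₁.X₁ 1 := (h₁.hasProjectiveDimensionLT_X₃_iff 0 p₁).1 q₁
  rw [← projective_iff_hasProjectiveDimensionLT_one, ← IsProjective.iff_projective] at q₂
  have q₃ : Module.Projective S (LinearMap.ker f) := q₂
  have q₄ : Module.Free S (LinearMap.ker f) := Module.free_of_flat_of_isLocalRing
  obtain ⟨ψ₀, hψ⟩ := hom_cyclic S I _ f hf e
  have hr1 := ker_finrank_le_one S _ (LinearMap.ker f) hker ψ₀ hψ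
  have hr2 := Submodule.finrank_quotient_add_finrank (LinearMap.ker f)
  rw [(f.quotKerEquivOfSurjective hf).finrank_eq] at hr2
  have hr3 : Module.finrank S I ≤ 1 := by
    simpa using Submodule.finrank_le I
  have hr : r ≤ 2 := by
    have : Module.finrank S (Fin r → S) = r := by simp
    omega
  have hspan : I = Ideal.span (Set.range fun i => (v i : S)) := by
    have := congrArg (Submodule.map I.subtype) hv
    rw [Submodule.map_span, ← Set.range_comp, Submodule.map_subtype_top] at this
    exact this.symm
  rw [hspan]
  interval_cases r
  · exact ⟨0, 0, by simp⟩
  · refine ⟨v 0, 0, ?_⟩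
    rw [Ideal.span_pair_zero]
    congr 1
    ext x
    simp [eq_comm]
  · refine ⟨v 0, v 1, ?_⟩
    congr 1
    ext x
    simp [Fin.exists_fin_two, eq_comm]

/-- Let `S` be a regular local ring and `I` a height-two ideal such that `R = S/I`
is Gorenstein (Cohen–Macaulay with `Ext²_S(R,S) ≅ R`).  Then `I` is generated by
two elements, i.e. `R` is a complete intersection. -/
theorem stmt_10 (S : Type) [CommRing S] [IsLocalRing S] [IsNoetherianRing S]
    (hreg : IsRegularLocal S)
    (I : Ideal S) (hI : I ≠ ⊤) [IsLocalRing (S ⧸ I)]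
    (hht : idealHeight I = 2)
    (hCM : IsCohenMacaulayLocal (S ⧸ I))
    (hExt : Nonempty ((ExtSMod S (S ⧸ I) 2) ≃ₗ[S] (S ⧸ I))) :
    ∃ f g : S, I = Ideal.span {f, g} := by
  obtain ⟨s, hs, hcard⟩ := hreg
  obtain ⟨hD, ys, -, hys, hyreg⟩ := regular_seq s.card S (fun i => (s.equivFin.symm i : S)) (by
    rw [← hs]
    congr 1
    ext x
    simp only [Set.mem_range, Finset.mem_coe]
    constructor
    · rintro ⟨i, rfl⟩
      exact (s.equivFin.symm i).2
    · intro hx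
      exact ⟨s.equivFin ⟨x, hx⟩, by simp⟩) hcard.symm
  obtain ⟨e₁⟩ := hExt
  obtain ⟨e₂⟩ := bridge S (ModuleCat.of S (S ⧸ I)) (ModuleCat.of S S)
  let e : CategoryTheory.Abelian.Ext (ModuleCat.of S (S ⧸ I)) (ModuleCat.of S S) 2 ≃ₗ[S] (S ⧸ I) :=
    e₂.symm.trans e₁
  have hnt : Nontrivial (CategoryTheory.Abelian.Ext (ModuleCat.of S (S ⧸ I)) (ModuleCat.of S S) 2) :=
    e.toEquiv.nontrivial
  exact two_gens S I (pd_two S ys hys hyreg I hCM hnt) e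
end

section
/- Let $(R, m)$ be a regular local ring of dimension $d$ with $m = (x_1, \dots, x_d)$, let $f_1, \dots, f_d$ be a system of parameters, and write $f_j = \sum_i a_{ij} x_i$ for a $d \times d$ matrix $A = (a_{ij})$ over $R$ with $\Delta = \det(A)$. Then $(f_1, \dots, f_d) :_R m = (f_1, \dots, f_d, \Delta)$; in particular the image of $\Delta$ generates the socle of $R/(f_1, \dots, f_d)$. -/
namespace Wiebe

open IsLocalRing

variable {R : Type*} [CommRing R]

/-- `y` is a non-zero-divisor modulo `I`. -/
def Reg (I : Ideal R) (y : R) : Prop := ∀ r, r * y ∈ I → r ∈ I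

lemma mem_ad {I : Ideal R} {y r : R} :
    r ∈ I ⊔ Ideal.span {y} ↔ ∃ s, r - s * y ∈ I := by
  rw [Submodule.mem_sup]
  constructor
  · rintro ⟨i, hi, z, hz, rfl⟩
    obtain ⟨s, rfl⟩ := Ideal.mem_span_singleton'.1 hz
    exact ⟨s, by simpa using hi⟩
  · rintro ⟨s, hs⟩
    exact ⟨_, hs, s * y, Ideal.mem_span_singleton'.2 ⟨s, rfl⟩, by ring⟩

lemma mem_ad_left {I : Ideal R} {y r : R} (h : r ∈ I) : r ∈ I ⊔ Ideal.span {y} :=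
  Ideal.mem_sup_left h

/-- Coset prime avoidance. -/
lemma avoid (S : Finset (Ideal R)) (hS : ∀ P ∈ S, P.IsPrime) (x : R) (J : Ideal R)
    (h : ∀ P ∈ S, x ∈ P → ¬ J ≤ P) : ∃ j ∈ J, ∀ P ∈ S, x + j ∉ P := by
  classical
  induction hn : S.card generalizing S with
  | zero =>
    rw [Finset.card_eq_zero] at hn
    subst hn
    exact ⟨0, J.zero_mem, by simp⟩
  | succ n ih =>
    have hne : S.Nonempty := by rw [← Finset.card_pos]; omega
    obtain ⟨P, hP⟩ := S.exists_minimal hne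
    obtain ⟨j, hj, hj'⟩ := ih (S.erase P) (fun Q hQ => hS Q (Finset.mem_of_mem_erase hQ))
      (fun Q hQ => h Q (Finset.mem_of_mem_erase hQ)) (by rw [Finset.card_erase_of_mem hP.1]; omega)
    by_cases hy : x + j ∈ P
    · have hPp := hS P hP.1
      have hJ : ¬ J ≤ P := fun hJ => h P hP.1 (by simpa using P.sub_mem hy (hJ hj)) hJ
      have hprod : ¬ J * ∏ Q ∈ S.erase P, Q ≤ P := by
        intro hle
        rcases (Ideal.IsPrime.mul_le hPp).1 hle with h1 | h1
        · exact hJ h1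
        · obtain ⟨Q, hQ, hQP⟩ := (Ideal.IsPrime.prod_le hPp).1 h1
          have := hP.2 (Finset.mem_of_mem_erase hQ) hQP
          exact (Finset.ne_of_mem_erase hQ) (le_antisymm hQP this)
      obtain ⟨k, hk, hkP⟩ := SetLike.not_le_iff_exists.1 hprod
      have hkJ : k ∈ J := (Ideal.mul_le_left : J * ∏ Q ∈ S.erase P, Q ≤ J) hk
      have hkS : k ∈ ∏ Q ∈ S.erase P, Q := (Ideal.mul_le_right : J * ∏ Q ∈ S.erase P, Q ≤ _) hk
      refine ⟨j + k, J.add_mem hj hkJ, fun Q hQ hmem => ?_⟩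
      by_cases hQP : Q = P
      · subst hQP
        exact hkP (by have := Q.sub_mem hmem hy; ring_nf at this; exact this)
      · have hQ' : Q ∈ S.erase P := Finset.mem_erase.2 ⟨hQP, hQ⟩
        have hkQ : k ∈ Q := by
          have h1 : ∏ Q ∈ S.erase P, Q ≤ Q :=
            Ideal.prod_le_inf.trans (Finset.inf_le hQ')
          exact h1 hkS
        apply hj' Q hQ'
        have := Q.sub_mem hmem hkQ
        ring_nf at this
        exact this
    · refine ⟨j, hj, fun Q hQ => ?_⟩
      by_cases hQP : Q = P
      · subst hQP; exact hy
      · exact hj' Q (Finset.mem_erase.2 ⟨hQP, hQ⟩)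

lemma exists_ass [IsNoetherianRing R] (I : Ideal R) : ∃ S : Finset (Ideal R),
    (∀ P ∈ S, P.IsPrime ∧ ∃ v, v ∉ I ∧ ∀ r, r ∈ P ↔ r * v ∈ I) ∧
    ∀ y, (∀ P ∈ S, y ∉ P) → Reg I y := by
  refine ⟨(associatedPrimes.finite R (R ⧸ I)).toFinset, ?_, ?_⟩
  · intro P hP
    rw [Set.Finite.mem_toFinset, AssociatedPrimes.mem_iff] at hP
    obtain ⟨hp, v, hv⟩ := Submodule.isAssociatedPrime_iff.1 hP
    obtain ⟨v, rfl⟩ := Ideal.Quotient.mk_surjective v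
    have key : ∀ r, r ∈ P ↔ r * v ∈ I := by
      intro r
      rw [hv, Submodule.mem_colon_singleton, Submodule.mem_bot, ← Ideal.Quotient.eq_zero_iff_mem,
        map_mul]
      rfl
    refine ⟨hp, v, fun hvI => hp.ne_top ?_, key⟩
    rw [Ideal.eq_top_iff_one, key]; simpa using hvI
  · intro y hy
    have h1 : y ∉ ⋃ p ∈ associatedPrimes R (R ⧸ I), (p : Set R) := by
      simpa using hy
    rw [biUnion_associatedPrimes_eq_compl_regular, Set.mem_compl_iff, not_not] at h1
    intro r hr
    have h2 : IsSMulRegular (R ⧸ I) y := h1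
    rw [← Ideal.Quotient.eq_zero_iff_mem]
    apply h2
    change y • (Ideal.Quotient.mk I) r = y • 0
    rw [smul_zero, ← Ideal.Quotient.eq_zero_iff_mem.2 hr, mul_comm r y, map_mul]
    rfl

/-- avoidance form for regular elements -/
lemma exists_reg [IsNoetherianRing R] (I : Ideal R) (z x : R) (hz : Reg I z) (J : Ideal R)
    (h : ∀ P : Ideal R, P.IsPrime → I ≤ P → x ∈ P → J ≤ P → z ∈ P) :
    ∃ j ∈ J, Reg I (x + j) := by
  obtain ⟨S, hS, hS'⟩ := exists_ass I
  obtain ⟨j, hj, hj'⟩ := avoid S (fun P hP => (hS P hP).1) x J (by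
    intro P hP hxP hJP
    obtain ⟨hp, v, hv, hk⟩ := hS P hP
    have := h P hp (fun r hr => (hk r).2 (I.mul_mem_right _ hr)) hxP hJP
    rw [hk, mul_comm] at this
    exact hv (hz _ this))
  exact ⟨j, hj, hS' _ hj'⟩

set_option linter.unusedSectionVars false
variable [IsLocalRing R] [IsNoetherianRing R]

lemma nak {T K : Ideal R} {a : R} (ha : a ∈ maximalIdeal R)
    (h : ∀ r ∈ T, ∃ s ∈ T, r - s * a ∈ K) : T ≤ K := by
  apply Submodule.le_of_le_smul_of_le_jacobson_bot (I := maximalIdeal R)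
    (IsNoetherian.noetherian T) (IsLocalRing.jacobson_eq_maximalIdeal _ bot_ne_top).ge
  intro r hr
  obtain ⟨s, hs, hk⟩ := h r hr
  rw [Submodule.mem_sup]
  exact ⟨_, hk, s * a, by rw [mul_comm]; exact Submodule.smul_mem_smul ha hs, by ring⟩

lemma two {K : Ideal R} {a y : R} (ha : a ∈ maximalIdeal R) (h1 : Reg K a)
    (h2 : Reg (K ⊔ Ideal.span {a}) y) : Reg K y ∧ Reg (K ⊔ Ideal.span {y}) a := by
  constructor
  · have : Submodule.colon K {y} ≤ K := by
      apply nak ha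
      intro r hr
      rw [Submodule.mem_colon_singleton, smul_eq_mul] at hr
      obtain ⟨s, hs⟩ := mem_ad.1 (h2 r (mem_ad_left hr))
      refine ⟨s, ?_, hs⟩
      rw [Submodule.mem_colon_singleton, smul_eq_mul]
      apply h1
      have := K.sub_mem hr (K.mul_mem_right y hs)
      ring_nf at this ⊢
      exact this
    intro r hr
    exact this (by rw [Submodule.mem_colon_singleton, smul_eq_mul]; exact hr)
  · intro r hr
    obtain ⟨s, hs⟩ := mem_ad.1 hr
    have h3 : s ∈ K ⊔ Ideal.span {a} := by
      apply h2
      rw [mem_ad]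
      exact ⟨r, by have := K.neg_mem hs; ring_nf at this ⊢; exact this⟩
    obtain ⟨t, ht⟩ := mem_ad.1 h3
    rw [mem_ad]
    refine ⟨t, h1 _ ?_⟩
    have := K.add_mem hs (K.mul_mem_right y ht)
    ring_nf at this ⊢
    exact this

/-- depth of `R/I` at least `n` -/
def Dep : ℕ → Ideal R → Prop
  | 0, _ => True
  | n + 1, I => ∃ y ∈ maximalIdeal R, Reg I y ∧ Dep n (I ⊔ Ideal.span {y})

/-- key transfer -/
lemma transfer {I : Ideal R} {x y v u : R} {w m : R} (hy : Reg I y)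
    (h1 : v * x - u * y ∈ I) (h2 : v * m - w * y ∈ I) : u * m ∈ I ⊔ Ideal.span {x} := by
  rw [mem_ad]
  refine ⟨w, hy _ ?_⟩
  have := I.sub_mem (I.mul_mem_right x h2) (I.mul_mem_right m h1)
  ring_nf at this ⊢
  exact this

lemma sup_swap (I : Ideal R) (x z : R) : I ⊔ Ideal.span {x} ⊔ Ideal.span {z} =
    I ⊔ Ideal.span {z} ⊔ Ideal.span {x} := sup_right_comm _ _ _

lemma dep_quot (n : ℕ) : ∀ (I : Ideal R) (y : R), y ∈ maximalIdeal R → Reg I y →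
    Dep (n + 1) I → Dep n (I ⊔ Ideal.span {y}) := by
  induction n with
  | zero => intro _ _ _ _ _; trivial
  | succ n ih =>
    rintro I y hym hy ⟨x, hxm, hx, hdx⟩
    obtain ⟨x2, hx2m, hx2, _⟩ := id hdx
    obtain ⟨S, hS, hS'⟩ := exists_ass (I ⊔ Ideal.span {x})
    obtain ⟨T, hT, hT'⟩ := exists_ass (I ⊔ Ideal.span {y})
    classical
    obtain ⟨z, hzm, hz⟩ := avoid (S ∪ T) (fun P hP => by
        rcases Finset.mem_union.1 hP with h | h
        exacts [(hS P h).1, (hT P h).1]) 0 (maximalIdeal R) (by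
      intro P hP _ hle
      rcases Finset.mem_union.1 hP with h | h
      · obtain ⟨_, v, hv, hk⟩ := hS P h
        have := (hk x2).1 (hle hx2m)
        rw [mul_comm] at this
        exact hv (hx2 _ this)
      · obtain ⟨_, v, hv, hk⟩ := hT P h
        apply hv
        obtain ⟨u, hu⟩ := mem_ad.1 ((hk x).1 (hle hxm))
        obtain ⟨w, hw⟩ := mem_ad.1 ((hk x2).1 (hle hx2m))
        rw [mul_comm] at hu hw
        have h3 := transfer hy hu hw
        obtain ⟨s, hs⟩ := mem_ad.1 (hx2 _ h3)
        rw [mem_ad]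
        refine ⟨s, hx _ ?_⟩
        have := I.add_mem hu (I.mul_mem_right y hs)
        ring_nf at this ⊢
        exact this)
    rw [zero_add] at hz
    have hzx := hS' z (fun P hP => hz P (Finset.mem_union_left _ hP))
    have hzy := hT' z (fun P hP => hz P (Finset.mem_union_right _ hP))
    have h1 := ih _ z hzm hzx hdx
    have h2 := two hxm hx hzx
    have h3 : Dep (n + 1) (I ⊔ Ideal.span {z}) := ⟨x, hxm, h2.2, by rw [sup_swap]; exact h1⟩
    have h4 := ih _ y hym (two hym hy hzy).2 h3
    exact ⟨z, hzm, hzy, by rw [sup_swap]; exact h4⟩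

/-- `f 0` is regular modulo `I + (f 1, ...)`, recursively. -/
def RS : (n : ℕ) → Ideal R → (Fin n → R) → Prop
  | 0, _, _ => True
  | n + 1, I, f => RS n I (Fin.tail f) ∧ Reg (I ⊔ Ideal.span (Set.range (Fin.tail f))) (f 0)

lemma span_range_succ {n : ℕ} (f : Fin (n + 1) → R) :
    Ideal.span (Set.range f) = Ideal.span {f 0} ⊔ Ideal.span (Set.range (Fin.tail f)) := by
  rw [← Ideal.span_union]
  congr 1
  conv_lhs => rw [← Fin.cons_self_tail f, Fin.range_cons]
  rfl

lemma rs_push (n : ℕ) : ∀ (I : Ideal R) (g : Fin n → R) (y : R), (∀ i, g i ∈ maximalIdeal R) →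
    RS n I g → Reg (I ⊔ Ideal.span (Set.range g)) y → RS n (I ⊔ Ideal.span {y}) g := by
  induction n with
  | zero => intros; trivial
  | succ n ih =>
    rintro I g y hm ⟨h1, h2⟩ h3
    rw [span_range_succ, sup_comm (Ideal.span {g 0}), ← sup_assoc] at h3
    have h4 := two (hm 0) h2 h3
    refine ⟨ih I _ y (fun i => hm i.succ) h1 h4.1, ?_⟩
    rw [sup_right_comm]
    exact h4.2

lemma rs_pull (n : ℕ) : ∀ (I : Ideal R) (g : Fin n → R) (y : R), y ∈ maximalIdeal R →
    Reg I y → RS n (I ⊔ Ideal.span {y}) g →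
    RS n I g ∧ Reg (I ⊔ Ideal.span (Set.range g)) y := by
  induction n with
  | zero =>
    intro I g y _ h _
    refine ⟨trivial, ?_⟩
    simpa using h
  | succ n ih =>
    rintro I g y hm hy ⟨h1, h2⟩
    obtain ⟨h3, h4⟩ := ih I _ y hm hy h1
    rw [sup_right_comm] at h2
    have h5 := two hm h4 h2
    refine ⟨⟨h3, h5.1⟩, ?_⟩
    rw [span_range_succ, sup_comm (Ideal.span {g 0}), ← sup_assoc]
    exact h5.2

lemma sup_congr_add {J : Ideal R} {a j : R} (hj : j ∈ J) :
    J ⊔ Ideal.span {a + j} = J ⊔ Ideal.span {a} := by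
  ext r
  rw [mem_ad, mem_ad]
  refine exists_congr fun s => ?_
  have e : r - s * a = (r - s * (a + j)) + s * j := by ring
  rw [e, Ideal.add_mem_iff_left _ (J.mul_mem_left s hj)]

/-- systems of parameters are regular sequences -/
lemma sop_rs (n : ℕ) : ∀ (I : Ideal R) (f : Fin n → R), (∀ i, f i ∈ maximalIdeal R) →
    maximalIdeal R ≤ (I ⊔ Ideal.span (Set.range f)).radical → Dep n I → RS n I f := by
  induction n with
  | zero => intros; trivial
  | succ n ih =>
    rintro I f hm hrad hdep
    obtain ⟨z, hzm, hz, _⟩ := id hdep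
    obtain ⟨j, hj, hreg⟩ := exists_reg I z (f 0) hz (Ideal.span (Set.range (Fin.tail f))) (by
      intro P hP hI h0 ht
      have : I ⊔ Ideal.span (Set.range f) ≤ P := by
        rw [span_range_succ]
        exact sup_le hI (sup_le ((Ideal.span_singleton_le_iff_mem _).2 h0) ht)
      exact hP.radical_le_iff.2 this (hrad hzm))
    have hjm : j ∈ maximalIdeal R := by
      refine (Ideal.span_le.2 ?_ : Ideal.span (Set.range (Fin.tail f)) ≤ maximalIdeal R) hj
      rintro _ ⟨i, rfl⟩
      exact hm _
    have hym : f 0 + j ∈ maximalIdeal R := Ideal.add_mem _ (hm 0) hjm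
    have hd := dep_quot n I _ hym hreg hdep
    have h1 := ih _ (Fin.tail f) (fun i => hm i.succ) (by
      rw [sup_right_comm, sup_congr_add (Ideal.mem_sup_right hj), sup_right_comm, sup_assoc,
        ← span_range_succ]
      exact hrad) hd
    obtain ⟨h2, h3⟩ := rs_pull n I _ _ hym hreg h1
    refine ⟨h2, fun r hr => h3 r ?_⟩
    rw [mul_add]
    exact Ideal.add_mem _ hr (Ideal.mul_mem_left _ _ (Ideal.mem_sup_right hj))

/-- regular local rings are Cohen-Macaulay -/
lemma regular_dep (n : ℕ) : ∀ (I : Ideal R) (x : Fin n → R),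
    I ⊔ Ideal.span (Set.range x) = maximalIdeal R →
    (∀ t : Finset R, (t : Set R) ⊆ maximalIdeal R →
      maximalIdeal R ≤ (I ⊔ Ideal.span (t : Set R)).radical → n ≤ t.card) →
    I.IsPrime ∧ Dep n I := by
  classical
  induction n with
  | zero =>
    intro I x hx _
    have : I = maximalIdeal R := by simpa using hx
    rw [this]
    exact ⟨inferInstance, trivial⟩
  | succ n ih =>
    intro I x hx ht
    have hIm : I ≤ maximalIdeal R := hx ▸ le_sup_left
    have hxm : Ideal.span (Set.range x) ≤ maximalIdeal R := hx ▸ le_sup_right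
    have hfin := Ideal.finite_minimalPrimes_of_isNoetherianRing R I
    obtain ⟨j, hj, hav⟩ := avoid hfin.toFinset
      (fun P hP => (hfin.mem_toFinset.1 hP).1.1) (x 0) (Ideal.span (Set.range (Fin.tail x))) (by
      intro P hP h0 hle
      have hP' := hfin.mem_toFinset.1 hP
      have hmP : maximalIdeal R ≤ P := by
        rw [← hx, span_range_succ]
        exact sup_le hP'.1.2 (sup_le ((Ideal.span_singleton_le_iff_mem _).2 h0) hle)
      have := ht ∅ (by simp) (by
        simp only [Finset.coe_empty, Ideal.span_empty, sup_bot_eq]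
        rw [Ideal.radical_eq_sInf]
        refine le_sInf ?_
        rintro Q ⟨hIQ, hQ⟩
        have hQm : Q ≤ P := (IsLocalRing.le_maximalIdeal hQ.ne_top).trans hmP
        exact hmP.trans (hP'.2 ⟨hQ, hIQ⟩ hQm))
      simp at this)
    set y := x 0 + j with hy
    have hspan : I ⊔ Ideal.span {y} ⊔ Ideal.span (Set.range (Fin.tail x)) = maximalIdeal R := by
      rw [sup_right_comm, hy, sup_congr_add (Ideal.mem_sup_right hj), sup_right_comm, sup_assoc,
        ← span_range_succ, hx]
    have hym : y ∈ maximalIdeal R := by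
      rw [← hspan]
      exact Ideal.mem_sup_left (Ideal.mem_sup_right (Ideal.mem_span_singleton_self y))
    obtain ⟨hp, hd⟩ := ih (I ⊔ Ideal.span {y}) (Fin.tail x) hspan (by
      intro t htm htt
      have := ht (insert y t) (by
        rw [Finset.coe_insert]
        exact Set.insert_subset hym htm) (by
        rw [Finset.coe_insert, Ideal.span_insert, ← sup_assoc]
        exact htt)
      have := Finset.card_insert_le y t
      omega)
    obtain ⟨p, hpm, hple⟩ := Ideal.exists_minimalPrimes_le (I := I) (J := I ⊔ Ideal.span {y})
      le_sup_left
    have hyp : y ∉ p := hav p (hfin.mem_toFinset.2 hpm)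
    have hpp : p.IsPrime := hpm.1.1
    have hpI : p ≤ I := by
      apply nak hym
      intro r hr
      obtain ⟨s, hs⟩ := mem_ad.1 (hple hr)
      refine ⟨s, ?_, hs⟩
      have h1 : s * y ∈ p := by
        have := p.sub_mem hr (hpm.1.2 hs)
        simpa using this
      exact (hpp.mem_or_mem h1).resolve_right hyp
    have hpeq : p = I := le_antisymm hpI hpm.1.2
    subst hpeq
    exact ⟨hpp, y, hym, fun r hr => (hpp.mem_or_mem hr).resolve_right hyp, hd⟩

/-- The main colon computation. -/
lemma colon_le (n : ℕ) : ∀ (I : Ideal R) (x f : Fin n → R) (A : Matrix (Fin n) (Fin n) R),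
    (∀ i, f i ∈ maximalIdeal R) → (∀ j, f j - ∑ i, A i j * x i ∈ I) → RS n I f →
    ∀ v, (∀ i, v * x i ∈ I ⊔ Ideal.span (Set.range f)) →
      v ∈ I ⊔ Ideal.span (Set.range f) ⊔ Ideal.span {A.det} := by
  induction n with
  | zero =>
    intro I x f A _ _ _ v _
    rw [Matrix.det_isEmpty, Ideal.span_singleton_one, sup_top_eq]
    trivial
  | succ n ih =>
    intro I x₀ f A₀ hm hf₀ hrs v hv₀
    obtain ⟨hrs', hreg⟩ := id hrs
    set G := I ⊔ Ideal.span (Set.range (Fin.tail f)) with hG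
    have hfG : I ⊔ Ideal.span (Set.range f) = G ⊔ Ideal.span {f 0} := by
      rw [span_range_succ, sup_comm (Ideal.span {f 0}), ← sup_assoc]
    -- change `x 0`
    obtain ⟨j, hj, hregx⟩ := exists_reg G (f 0) (x₀ 0) hreg
      (Ideal.span (Set.range (Fin.tail x₀))) (by
        intro P _ hGP h0 ht
        have h1 := hGP (Ideal.mem_sup_left (hf₀ 0))
        have h2 : ∑ i, A₀ i 0 * x₀ i ∈ P := by
          refine P.sum_mem fun i _ => P.mul_mem_left _ ?_
          refine Fin.cases h0 (fun i => ht (Ideal.subset_span ⟨i, rfl⟩)) i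
        simpa using P.add_mem h1 h2)
    obtain ⟨c, hc⟩ := (Ideal.mem_span_range_iff_exists_fun).1 hj
    set x : Fin (n + 1) → R := Fin.cons (x₀ 0 + j) (Fin.tail x₀) with hxdef
    let A : Matrix (Fin (n + 1)) (Fin (n + 1)) R := fun i k =>
      A₀ i k - (Fin.cons 0 c : Fin (n + 1) → R) i * A₀ 0 k
    have hdet : A.det = A₀.det := by
      refine Matrix.det_eq_of_forall_row_eq_smul_add_const
        (fun i => - (Fin.cons 0 c : Fin (n + 1) → R) i) 0 (by simp) ?_
      intro i k
      simp only [A]; ring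
    have hf : ∀ k, f k - ∑ i, A i k * x i ∈ I := by
      intro k
      convert hf₀ k using 2
      rw [Fin.sum_univ_succ, Fin.sum_univ_succ]
      simp only [A, x, Fin.cons_zero, Fin.cons_succ, Fin.tail, ← hc, sub_mul,
        Finset.sum_sub_distrib, zero_mul, sub_zero, mul_add, Finset.mul_sum]
      have : ∀ i, c i * A₀ 0 k * x₀ i.succ = A₀ 0 k * (c i * x₀ i.succ) := fun i => by ring
      simp only [this]
      ring
    have hv : ∀ i, v * x i ∈ I ⊔ Ideal.span (Set.range f) := by
      have hvj : v * j ∈ I ⊔ Ideal.span (Set.range f) := by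
        rw [← hc, Finset.mul_sum]
        refine Ideal.sum_mem _ fun i _ => ?_
        rw [mul_left_comm]
        exact Ideal.mul_mem_left _ _ (hv₀ i.succ)
      intro i
      refine Fin.cases ?_ (fun i => ?_) i
      · simp only [x, Fin.cons_zero, mul_add]
        exact Ideal.add_mem _ (hv₀ 0) hvj
      · simp only [x, Fin.cons_succ]
        exact hv₀ i.succ
    have hx0 : Reg G (x 0) := by simpa [x] using hregx
    rw [← hdet, hfG]
    rw [hfG] at hv
    clear_value x A
    clear hc hxdef hv₀ hf₀ hdet hregx
    -- Cramer
    have hcr : A.det * x 0 - (A.submatrix Fin.succ Fin.succ).det * f 0 ∈ G := by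
      have h1 : ∑ k, A.adjugate k 0 * (f k - ∑ i, A i k * x i) ∈ I :=
        I.sum_mem fun k _ => I.mul_mem_left _ (hf k)
      have h2 : ∑ k, A.adjugate k 0 * ∑ i, A i k * x i = A.det * x 0 := by
        simp only [Finset.mul_sum]
        rw [Finset.sum_comm]
        have : ∀ i, ∑ k, A.adjugate k 0 * (A i k * x i) = (A * A.adjugate) i 0 * x i := by
          intro i
          rw [Matrix.mul_apply, Finset.sum_mul]
          exact Finset.sum_congr rfl fun k _ => by ring
        simp only [this, Matrix.mul_adjugate, Matrix.smul_apply, Matrix.one_apply, smul_eq_mul]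
        simp
      simp only [mul_sub, Finset.sum_sub_distrib, h2] at h1
      rw [Fin.sum_univ_succ] at h1
      have h3 : A.adjugate 0 0 = (A.submatrix Fin.succ Fin.succ).det := by
        rw [Matrix.adjugate_fin_succ_eq_det_submatrix]
        simp [Fin.succAbove_zero]
      rw [h3] at h1
      have h4 : ∑ k : Fin n, A.adjugate k.succ 0 * f k.succ ∈ G :=
        G.sum_mem fun k _ => G.mul_mem_left _
          (Ideal.mem_sup_right (Ideal.subset_span ⟨k, rfl⟩))
      have h5 := G.sub_mem h4 (Ideal.mem_sup_left h1 : _ ∈ G)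
      convert h5 using 1
      ring
    obtain ⟨u, hu⟩ := mem_ad.1 (hv 0)
    have hux : ∀ i, u * x i ∈ G ⊔ Ideal.span {x 0} := by
      intro i
      obtain ⟨w, hw⟩ := mem_ad.1 (hv i)
      exact transfer hreg hu hw
    have hG' : I ⊔ Ideal.span {x 0} ⊔ Ideal.span (Set.range (Fin.tail f)) =
      G ⊔ Ideal.span {x 0} := by rw [sup_right_comm]
    have hih := ih (I ⊔ Ideal.span {x 0}) (Fin.tail x) (Fin.tail f) (A.submatrix Fin.succ Fin.succ)
      (fun i => hm i.succ) (by
        intro k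
        rw [mem_ad]
        refine ⟨A 0 k.succ, ?_⟩
        have := hf k.succ
        rw [Fin.sum_univ_succ] at this
        convert this using 1
        simp only [Fin.tail, Matrix.submatrix_apply]
        ring)
      (rs_push n I _ _ (fun i => hm i.succ) hrs' hx0) u (by
        intro i
        rw [hG']
        exact hux i.succ)
    rw [hG', sup_right_comm] at hih
    obtain ⟨s, hs⟩ := mem_ad.1 hih
    obtain ⟨e, he⟩ := mem_ad.1 hs
    rw [mem_ad]
    refine ⟨e, mem_ad.2 ⟨s, hx0 _ ?_⟩⟩
    have h6 := G.sub_mem (G.add_mem hu (G.mul_mem_left (f 0) he)) (G.mul_mem_left e hcr)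
    convert h6 using 1
    ring

end Wiebe

/-- Let `(R,m)` be a regular local ring of dimension `d` with `m = (x₁,…,x_d)`,
`f₁,…,f_d` a system of parameters with `f_j = ∑ᵢ aᵢⱼ xᵢ`, and `Δ = det(aᵢⱼ)`.
Then `(f₁,…,f_d) : m = (f₁,…,f_d, Δ)`; in particular the image of `Δ` generates
the socle of `R/(f₁,…,f_d)`. -/
theorem stmt_14 (R : Type*) [CommRing R] [IsLocalRing R] [IsNoetherianRing R]
    (d : ℕ) (hdim : ringKrullDim R = d)
    (x f : Fin d → R)
    (hx : Ideal.span (Set.range x) = IsLocalRing.maximalIdeal R)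
    (A : Matrix (Fin d) (Fin d) R)
    (hf : ∀ j, f j = ∑ i, A i j * x i)
    (hsop : (Ideal.span (Set.range f)).radical = IsLocalRing.maximalIdeal R) :
    Submodule.colon (Ideal.span (Set.range f)) (IsLocalRing.maximalIdeal R)
      = Ideal.span (Set.range f ∪ {A.det}) := by
  classical
  have hfm : Ideal.span (Set.range f) ≤ IsLocalRing.maximalIdeal R := hsop ▸ Ideal.le_radical
  have hfm' : ∀ i, f i ∈ IsLocalRing.maximalIdeal R := fun i =>
    hfm (Ideal.subset_span ⟨i, rfl⟩)
  have hxm : ∀ i, x i ∈ IsLocalRing.maximalIdeal R := fun i =>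
    hx ▸ Ideal.subset_span ⟨i, rfl⟩
  have hdep : Wiebe.Dep d (⊥ : Ideal R) := by
    refine (Wiebe.regular_dep d ⊥ x (by rw [bot_sup_eq, hx]) ?_).2
    intro t htm ht
    rw [bot_sup_eq] at ht
    replace htm := Ideal.span_le.2 htm
    · have hmin : IsLocalRing.maximalIdeal R ∈ (Ideal.span (t : Set R)).minimalPrimes := by
        refine ⟨⟨inferInstance, htm⟩, fun Q hQ _ => ?_⟩
        exact ht.trans (hQ.1.radical_le_iff.2 hQ.2)
      have h1 := Ideal.height_le_card_of_mem_minimalPrimes_span_finset hmin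
      have h2 := IsLocalRing.maximalIdeal_height_eq_ringKrullDim (R := R)
      rw [hdim] at h2
      have h3 : (IsLocalRing.maximalIdeal R).height = (d : ℕ∞) := by exact_mod_cast h2
      rw [h3] at h1
      exact_mod_cast h1
  have hrs : Wiebe.RS d (⊥ : Ideal R) f :=
    Wiebe.sop_rs d ⊥ f hfm' (by rw [bot_sup_eq, hsop]) hdep
  rw [Ideal.span_union]
  apply le_antisymm
  · intro v hv
    have := Wiebe.colon_le d ⊥ x f A hfm' (fun j => by rw [hf j]; simp) hrs v (by
      intro i
      rw [bot_sup_eq]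
      exact Submodule.mem_colon.1 hv _ (hxm i))
    rwa [bot_sup_eq] at this
  · refine sup_le ?_ ?_
    · intro r hr
      rw [Submodule.mem_colon]
      intro p _
      exact Ideal.mul_mem_right _ _ hr
    · rw [Ideal.span_singleton_le_iff_mem, Submodule.mem_colon]
      intro p hp
      have hp' : p ∈ IsLocalRing.maximalIdeal R := hp
      rw [← hx, Ideal.mem_span_range_iff_exists_fun] at hp'
      obtain ⟨c, rfl⟩ := hp'
      rw [smul_eq_mul, Finset.mul_sum]
      refine Ideal.sum_mem _ fun i _ => ?_
      rw [mul_left_comm]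
      refine Ideal.mul_mem_left _ _ ?_
      have h2 : ∑ k, A.adjugate k i * f k = A.det * x i := by
        simp only [hf, Finset.mul_sum]
        rw [Finset.sum_comm]
        have : ∀ l, ∑ k, A.adjugate k i * (A l k * x l) = (A * A.adjugate) l i * x l := by
          intro l
          rw [Matrix.mul_apply, Finset.sum_mul]
          exact Finset.sum_congr rfl fun k _ => by ring
        simp only [this, Matrix.mul_adjugate, Matrix.smul_apply, Matrix.one_apply, smul_eq_mul]
        simp
      rw [← h2]
      exact Ideal.sum_mem _ fun k _ => Ideal.mul_mem_left _ _ (Ideal.subset_span ⟨k, rfl⟩)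
end

section
/- Let $R$ be a zero-dimensional Gorenstein local ring (i.e., Artinian with one-dimensional socle, equivalently self-injective) and let $J \subseteq R$ be an ideal. Then $R/J$ is Gorenstein if and only if $J = 0 :_R g$ for some nonzero element $g \in R$; in that case $gR = 0 :_R J$. -/
namespace Stmt16

open IsLocalRing

variable {R : Type*} [CommRing R] [IsLocalRing R] [IsArtinianRing R]

/-- Socle elements exist below any nonzero element of a quotient. -/
lemma exists_socle (J : Ideal R) (z : R) (hz : z ∉ J) :
    ∃ w : R, w * z ∉ J ∧ ∀ t ∈ maximalIdeal R, t * (w * z) ∈ J := by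
  classical
  obtain ⟨n, hn⟩ := (IsArtinianRing.isNilpotent_jacobson_bot (R := R))
  rw [IsLocalRing.jacobson_eq_maximalIdeal _ bot_ne_top] at hn
  have hex : ∃ n : ℕ, ∀ w ∈ maximalIdeal R ^ n, w * z ∈ J := by
    refine ⟨n, fun w hw => ?_⟩
    rw [hn] at hw
    have : w = 0 := by simpa using hw
    simp [this]
  have hs := Nat.find_spec hex
  have hm := fun k => Nat.find_min hex (m := k)
  generalize Nat.find hex = k at hs hm
  cases k with
  | zero =>
    exact absurd (by simpa using hs 1 (by simp)) hz
  | succ k =>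
    have := hm k (Nat.lt_succ_self k)
    push Not at this
    obtain ⟨w, hw, hwz⟩ := this
    refine ⟨w, hwz, fun t ht => ?_⟩
    rw [← mul_assoc, mul_comm t w]
    exact hs _ (by rw [pow_succ]; exact Ideal.mul_mem_mul hw ht)

lemma mem_of_ne_bot {e : R} (hs : (maximalIdeal R).annihilator = Ideal.span {e})
    (g : R) (hg : g ≠ 0) : ∃ y, g * y = e := by
  obtain ⟨w, hw, h⟩ := exists_socle (⊥ : Ideal R) g (by simpa using hg)
  have h1 : w * g ∈ (maximalIdeal R).annihilator := by
    rw [Submodule.mem_annihilator]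
    intro t ht
    have := h t ht
    rw [Ideal.mem_bot] at this
    rw [smul_eq_mul, mul_comm, this]
  have he : e ∈ (maximalIdeal R).annihilator := by
    rw [hs]; exact Ideal.mem_span_singleton_self e
  rw [hs, Ideal.mem_span_singleton'] at h1
  obtain ⟨a, ha⟩ := h1
  by_cases hu : IsUnit a
  · obtain ⟨u, rfl⟩ := hu
    refine ⟨↑u⁻¹ * w, ?_⟩
    calc g * (↑u⁻¹ * w) = ↑u⁻¹ * (w * g) := by ring
      _ = ↑u⁻¹ * (↑u * e) := by rw [ha]
      _ = e := by simp
  · exfalso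
    apply hw
    have := (Submodule.mem_annihilator.1 he) a ((mem_maximalIdeal a).2 hu)
    rw [← ha, Ideal.mem_bot, mul_comm]; exact this

lemma length_span_e {e : R} (he : e ≠ 0) (hs : (maximalIdeal R).annihilator = Ideal.span {e}) :
    Module.length R (Ideal.span {e} : Ideal R) = 1 := by
  rw [Module.length_eq_one_iff]
  rw [isSimpleModule_iff_isAtom]
  refine ⟨by simpa using he, fun b hb => ?_⟩
  by_contra hne
  obtain ⟨g, hg, hg0⟩ := Submodule.exists_mem_ne_zero_of_ne_bot hne
  obtain ⟨y, hy⟩ := mem_of_ne_bot hs g hg0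
  refine hb.not_ge ?_
  rw [Ideal.span_singleton_le_iff_mem, ← hy]
  exact Ideal.mul_mem_right _ b hg

lemma step {e : R} (he : e ≠ 0) (hs : (maximalIdeal R).annihilator = Ideal.span {e})
    {A B : Ideal R} (h : A ⋖ B) :
    Order.height A.annihilator + Order.height A ≤ Order.height B.annihilator + Order.height B := by
  obtain ⟨x, hxB, hxA⟩ := SetLike.exists_of_lt h.lt
  have hB : A ⊔ Ideal.span {x} = B := by
    refine (h.eq_or_eq le_sup_left (sup_le h.le (by simpa [Ideal.span_singleton_le_iff_mem] using hxB))).resolve_left ?_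
    intro hh
    exact hxA (hh ▸ Ideal.mem_sup_right (Ideal.mem_span_singleton_self x))
  have hmx : ∀ t ∈ maximalIdeal R, t * x ∈ A := by
    intro t ht
    by_contra hc
    have h2 : A ⊔ Ideal.span {t * x} = B := by
      refine (h.eq_or_eq le_sup_left (sup_le h.le ?_)).resolve_left ?_
      · rw [Ideal.span_singleton_le_iff_mem]; exact B.mul_mem_left _ hxB
      · intro hh
        exact hc (hh ▸ Ideal.mem_sup_right (Ideal.mem_span_singleton_self _))
    rw [← h2, Submodule.mem_sup] at hxB
    obtain ⟨a, ha, b, hb, hab⟩ := hxB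
    obtain ⟨c, rfl⟩ := Ideal.mem_span_singleton'.1 hb
    have hu : IsUnit (1 - c * t) := by
      by_contra hu
      have h1 := (mem_maximalIdeal _).2 hu
      have h3 := Ideal.add_mem _ h1 (Ideal.mul_mem_left _ c ht)
      rw [sub_add_cancel] at h3
      exact (Ideal.ne_top_iff_one _).1 (maximalIdeal.isMaximal R).ne_top h3
    have h4 : (1 - c * t) * x = a := by linear_combination -hab
    apply hxA
    rw [← h4] at ha
    obtain ⟨u, hu⟩ := hu
    rw [← hu] at ha
    simpa using A.mul_mem_left (↑u⁻¹) ha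
  have hlt : Order.height A + 1 ≤ Order.height B :=
    Order.add_one_le_of_lt (Submodule.height_strictMono h.lt)
  have hann : Order.height A.annihilator ≤ Order.height B.annihilator + 1 := by
    rw [← Module.length_submodule, ← Module.length_submodule]
    let φ : A.annihilator →ₗ[R] (Ideal.span {e} : Ideal R) :=
      ((LinearMap.mulRight R x).comp A.annihilator.subtype).codRestrict _ (by
        intro r
        rw [← hs, Submodule.mem_annihilator]
        intro t ht
        have := (Submodule.mem_annihilator.1 r.2) _ (hmx t ht)
        simp only [smul_eq_mul] at this
        simp only [LinearMap.comp_apply, Submodule.subtype_apply, LinearMap.mulRight_apply,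
          smul_eq_mul]
        linear_combination this)
    have hl := Module.length_eq_add_of_exact (LinearMap.ker φ).subtype φ.rangeRestrict
      Subtype.val_injective φ.surjective_rangeRestrict (by
        intro y
        constructor
        · intro hy
          have hy' : φ y = 0 := congrArg Subtype.val hy
          exact ⟨⟨y, hy'⟩, rfl⟩
        · rintro ⟨k, rfl⟩
          exact Subtype.ext k.2)
    rw [hl]
    refine add_le_add ?_ ?_
    · refine Module.length_le_of_injective
        ((A.annihilator.subtype.comp (LinearMap.ker φ).subtype).codRestrict B.annihilator ?_) ?_
      · rintro ⟨⟨r, hr⟩, hrk⟩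
        have hrx : r * x = 0 := by
          have := congrArg Subtype.val (LinearMap.mem_ker.1 hrk)
          simpa [φ] using this
        simp only [LinearMap.comp_apply, Submodule.subtype_apply]
        rw [← hB, Submodule.mem_annihilator]
        intro n hn
        obtain ⟨a, ha, b, hb, rfl⟩ := Submodule.mem_sup.1 hn
        obtain ⟨c, rfl⟩ := Ideal.mem_span_singleton'.1 hb
        have h0 := (Submodule.mem_annihilator.1 hr) a ha
        simp only [smul_eq_mul] at h0 ⊢
        linear_combination h0 + c * hrx
      · intro a b hab
        have := congrArg Subtype.val hab
        exact Subtype.ext (Subtype.ext this)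
    · rw [← length_span_e he hs]
      exact Module.length_le_of_injective (LinearMap.range φ).subtype Subtype.val_injective
  calc _ ≤ (Order.height B.annihilator + 1) + Order.height A := by gcongr
    _ = Order.height B.annihilator + (Order.height A + 1) := by ring
    _ ≤ _ := by gcongr

lemma const {e : R} (he : e ≠ 0) (hs : (maximalIdeal R).annihilator = Ideal.span {e})
    (I : Ideal R) : Order.height I.annihilator + Order.height I = Order.height (⊤ : Ideal R) := by
  apply le_antisymm
  · induction I using WellFoundedGT.induction with
    | ind I ih =>
      by_cases hI : I = ⊤
      · subst hI
        have : (⊤ : Ideal R).annihilator = ⊥ := by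
          rw [eq_bot_iff]; intro r hr
          simpa using (Submodule.mem_annihilator.1 hr) 1 trivial
        rw [this]; simp
      · obtain ⟨B, hB⟩ := exists_covBy_of_wellFoundedLT (a := I) (by simpa using hI)
        exact (step he hs hB).trans (ih B hB.lt)
  · induction I using WellFoundedLT.induction with
    | ind I ih =>
      by_cases hI : I = ⊥
      · subst hI
        have : (⊥ : Ideal R).annihilator = ⊤ := Submodule.annihilator_bot
        rw [this]; simp
      · obtain ⟨B, hB⟩ := exists_covBy_of_wellFoundedGT (a := I) (by simpa using hI)
        exact (ih B hB.lt).trans (step he hs hB)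

lemma double_ann {e : R} (he : e ≠ 0) (hs : (maximalIdeal R).annihilator = Ideal.span {e})
    (I : Ideal R) : I.annihilator.annihilator = I := by
  have hle : I ≤ I.annihilator.annihilator := by
    intro x hx
    rw [Submodule.mem_annihilator]
    intro r hr
    rw [smul_eq_mul, mul_comm]
    exact (Submodule.mem_annihilator.1 hr) x hx
  by_contra hne
  have hlt := Submodule.height_strictMono (lt_of_le_of_ne hle (Ne.symm hne))
  have h1 := const he hs I
  have h2 := const he hs I.annihilator
  rw [← h1, add_comm] at h2
  have := ENat.add_right_injective_of_ne_top (Submodule.height_lt_top I.annihilator).ne h2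
  exact hlt.ne this.symm

end Stmt16

/-- Let `(R,m)` be a 0-dimensional Gorenstein local ring (Artinian with
one-dimensional socle).  An ideal `J` gives a Gorenstein quotient `R/J` (i.e. one
with one-dimensional socle) iff `J = 0 :_R g` for some nonzero `g ∈ R`, in which
case `gR = 0 :_R J`. -/
theorem stmt_16 (R : Type*) [CommRing R] [IsLocalRing R] [IsArtinianRing R]
    (hGor : ∃ e : R, e ≠ 0 ∧
      Submodule.colon (⊥ : Ideal R) (IsLocalRing.maximalIdeal R) = Ideal.span {e})
    (J : Ideal R) :
    ((∃ x : R ⧸ J, x ≠ 0 ∧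
        Submodule.colon (⊥ : Ideal (R ⧸ J))
            (Ideal.map (Ideal.Quotient.mk J) (IsLocalRing.maximalIdeal R))
          = Ideal.span {x})
      ↔ ∃ g : R, g ≠ 0 ∧ J = Submodule.colon (⊥ : Ideal R) (Ideal.span {g})) ∧
    (∀ g : R, g ≠ 0 → J = Submodule.colon (⊥ : Ideal R) (Ideal.span {g}) →
      Ideal.span {g} = Submodule.colon (⊥ : Ideal R) J) := by
  obtain ⟨e, he, hs⟩ := hGor
  simp only [Submodule.bot_colon] at hs ⊢
  have memspan : ∀ g z : R, z ∈ (Ideal.span {g}).annihilator ↔ z * g = 0 := by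
    intro g z
    rw [Submodule.mem_annihilator_span_singleton, smul_eq_mul]
  have hsoc : ∀ z : R, Ideal.Quotient.mk J z ∈
      (Ideal.map (Ideal.Quotient.mk J) (IsLocalRing.maximalIdeal R)).annihilator ↔
      ∀ t ∈ IsLocalRing.maximalIdeal R, t * z ∈ J := by
    intro z
    rw [Submodule.mem_annihilator]
    constructor
    · intro h t ht
      have := h _ (Ideal.mem_map_of_mem _ ht)
      rw [smul_eq_mul, ← map_mul, Ideal.Quotient.eq_zero_iff_mem, mul_comm] at this
      exact this
    · intro h n hn
      obtain ⟨t, ht, rfl⟩ := (Ideal.mem_map_iff_of_surjective _ Ideal.Quotient.mk_surjective).1 hn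
      rw [smul_eq_mul, ← map_mul, Ideal.Quotient.eq_zero_iff_mem, mul_comm]
      exact h t ht
  refine ⟨⟨?_, ?_⟩, ?_⟩
  · rintro ⟨x, hx, hxs⟩
    obtain ⟨y, rfl⟩ := Ideal.Quotient.mk_surjective x
    have hyJ : y ∉ J := fun h => hx (Ideal.Quotient.eq_zero_iff_mem.2 h)
    have hy := (hsoc y).1 (by rw [hxs]; exact Ideal.mem_span_singleton_self _)
    obtain ⟨g, hgJ, hgy⟩ : ∃ g ∈ J.annihilator, y * g ≠ 0 := by
      by_contra hc
      push Not at hc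
      apply hyJ
      rw [← Stmt16.double_ann he hs J, Submodule.mem_annihilator]
      exact hc
    refine ⟨g, fun h => hgy (by simp [h]), le_antisymm ?_ ?_⟩
    · intro j hj
      rw [memspan, mul_comm]
      exact (Submodule.mem_annihilator.1 hgJ) j hj
    · intro z hz
      by_contra hzJ
      rw [memspan] at hz
      obtain ⟨w, hw, hwm⟩ := Stmt16.exists_socle J z hzJ
      have h1 := (hsoc _).2 hwm
      rw [hxs, Ideal.mem_span_singleton'] at h1
      obtain ⟨r, hr⟩ := h1
      obtain ⟨r, rfl⟩ := Ideal.Quotient.mk_surjective r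
      rw [← map_mul, Ideal.Quotient.eq] at hr
      by_cases hu : IsUnit r
      · apply hgy
        have h2 : (r * y - w * z) * g = 0 := by
          rw [mul_comm]; exact (Submodule.mem_annihilator.1 hgJ) _ hr
        have h3 : r * (y * g) = 0 := by linear_combination h2 + w * hz
        exact hu.mul_right_eq_zero.1 h3
      · apply hw
        have := J.sub_mem (hy r ((IsLocalRing.mem_maximalIdeal r).2 hu)) hr
        simpa using this
  · rintro ⟨g, hg, rfl⟩
    obtain ⟨y, hy⟩ := Stmt16.mem_of_ne_bot hs g hg
    refine ⟨Ideal.Quotient.mk _ y, ?_, ?_⟩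
    · rw [Ne, Ideal.Quotient.eq_zero_iff_mem, memspan, mul_comm, hy]
      exact he
    · ext z
      obtain ⟨z, rfl⟩ := Ideal.Quotient.mk_surjective z
      rw [hsoc, Ideal.mem_span_singleton']
      constructor
      · intro h
        have h1 : z * g ∈ (IsLocalRing.maximalIdeal R).annihilator := by
          rw [Submodule.mem_annihilator]
          intro t ht
          have := (memspan _ _).1 (h t ht)
          rw [smul_eq_mul]
          linear_combination this
        rw [hs, Ideal.mem_span_singleton'] at h1
        obtain ⟨r, hr⟩ := h1
        refine ⟨Ideal.Quotient.mk _ r, ?_⟩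
        rw [← map_mul, Ideal.Quotient.eq, memspan]
        linear_combination hr + r * hy
      · rintro ⟨r, hr⟩ t ht
        obtain ⟨r, rfl⟩ := Ideal.Quotient.mk_surjective r
        rw [← map_mul, Ideal.Quotient.eq, memspan] at hr
        rw [memspan]
        have h1 : e ∈ (IsLocalRing.maximalIdeal R).annihilator := by
          rw [hs]; exact Ideal.mem_span_singleton_self e
        have h2 := (Submodule.mem_annihilator.1 h1) t ht
        rw [smul_eq_mul] at h2
        linear_combination (-t) * hr + r * h2 + r * t * hy
  · rintro g hg rfl
    exact (Stmt16.double_ann he hs _).symm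
end
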